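/- Let (C_i)_{i∈ℤ₊} be abelian categories and let F_{i-1,i}: C_i → C_{i-1} be exact functors. Then the inverse limit category lim C_i is abelian: every morphism f = {f_i}: C → D has a kernel and a cokernel, given componentwise by Ker(f) = ({Ker(f_i)}, {ρ_{i-1,i}}) and Coker(f) = ({Coker(f_i)}, {μ_{i-1,i}}) where ρ_{i-1,i} and μ_{i-1,i} are the unique maps induced by the structure isomorphisms using exactness of F_{i-1,i}; and for every morphism f in lim C_i the canonical map Coim(f) → Im(f) is an isomorphism. -/

import Mathlib

open CategoryTheory Limits

universe v u

namespace InvLim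

variable {C : ℕ → Type u} [∀ i, Category.{v} (C i)]

/-- An object of the inverse limit category: a family of objects `obj i ∈ C i` together with
isomorphisms `φ_{i,i+1} : F i (obj (i+1)) ≅ obj i`. -/
structure Obj (F : ∀ i : ℕ, C (i + 1) ⥤ C i) where
  obj : ∀ i, C i
  iso : ∀ i, (F i).obj (obj (i + 1)) ≅ obj i

variable (F : ∀ i : ℕ, C (i + 1) ⥤ C i)

/-- A morphism in the inverse limit category: a family of componentwise morphisms compatible
with the structure isomorphisms. -/
@[ext]
structure Hom (X Y : Obj F) where
  hom : ∀ i, X.obj i ⟶ Y.obj i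
  comm : ∀ i, (F i).map (hom (i + 1)) ≫ (Y.iso i).hom = (X.iso i).hom ≫ hom i

/-- The inverse limit category `lim C_i`. -/
instance : Category (Obj F) where
  Hom X Y := Hom F X Y
  id X := ⟨fun _ => 𝟙 _, fun i => by simp⟩
  comp f g := ⟨fun i => f.hom i ≫ g.hom i, fun i => by
    rw [Functor.map_comp, Category.assoc, g.comm, ← Category.assoc, f.comm, Category.assoc]⟩
  id_comp f := by apply Hom.ext; funext i; exact Category.id_comp _
  comp_id f := by apply Hom.ext; funext i; exact Category.comp_id _
  assoc f g h := by apply Hom.ext; funext i; exact Category.assoc _ _ _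

/-- The componentwise morphisms of a morphism in the inverse limit category. -/
def homApp {X Y : Obj F} (f : X ⟶ Y) (i : ℕ) : X.obj i ⟶ Y.obj i :=
  Hom.hom f i

/-- The projection functor `Pr i : lim C_j ⥤ C i`. -/
def Pr (i : ℕ) : Obj F ⥤ C i where
  obj X := X.obj i
  map f := Hom.hom f i
  map_id _ := rfl
  map_comp _ _ := rfl

end InvLim

namespace InvLim

variable {C : ℕ → Type u} [∀ i, Category.{v} (C i)] {F : ∀ i : ℕ, C (i + 1) ⥤ C i}

@[ext]
lemma hom_ext {X Y : Obj F} {f g : X ⟶ Y} (h : ∀ i, (Pr F i).map f = (Pr F i).map g) : f = g :=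
  Hom.ext (funext h)

variable (F) in
/-- The structure isomorphisms of the objects, assembled into natural isomorphisms. -/
def prIso (i : ℕ) : Pr F (i + 1) ⋙ F i ≅ Pr F i :=
  NatIso.ofComponents (fun X => X.iso i) (fun f => Hom.comm f i)

lemma map_comp_prIso {X Y : Obj F} (f : X ⟶ Y) (i : ℕ) :
    (F i).map ((Pr F (i + 1)).map f) ≫ (prIso F i).hom.app Y =
      (prIso F i).hom.app X ≫ (Pr F i).map f :=
  Hom.comm f i

lemma map_comp_prIso_assoc {X Y : Obj F} (f : X ⟶ Y) (i : ℕ) {Z : C i}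
    (h : (Pr F i).obj Y ⟶ Z) :
    (F i).map ((Pr F (i + 1)).map f) ≫ (prIso F i).hom.app Y ≫ h =
      (prIso F i).hom.app X ≫ (Pr F i).map f ≫ h := by
  rw [← Category.assoc, map_comp_prIso, Category.assoc]

/-- A constructor for morphisms in the inverse limit category, phrased with the projections. -/
def homMk {X Y : Obj F} (f : ∀ i, (Pr F i).obj X ⟶ (Pr F i).obj Y)
    (hf : ∀ i, (F i).map (f (i + 1)) ≫ (prIso F i).hom.app Y = (prIso F i).hom.app X ≫ f i) :
    X ⟶ Y :=
  Hom.mk f hf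

lemma isIso_of_forall_pr {X Y : Obj F} (f : X ⟶ Y) (hf : ∀ i, IsIso ((Pr F i).map f)) :
    IsIso f := by
  refine ⟨homMk (fun i => inv ((Pr F i).map f)) fun i => ?_, ?_, ?_⟩
  · rw [← cancel_epi ((F i).map ((Pr F (i + 1)).map f)), ← Functor.map_comp_assoc,
      IsIso.hom_inv_id, CategoryTheory.Functor.map_id, Category.id_comp, map_comp_prIso_assoc,
      IsIso.hom_inv_id, Category.comp_id]
  · ext i
    exact IsIso.hom_inv_id ((Pr F i).map f)
  · ext i
    exact IsIso.inv_hom_id ((Pr F i).map f)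

section Limits

variable {J : Type*} [Category* J] (K : J ⥤ Obj F)

/-- A cone in the inverse limit category is limiting as soon as its components are. -/
def isLimitOfPr (c : Cone K) (hc : ∀ i, IsLimit ((Pr F i).mapCone c)) : IsLimit c where
  lift s := homMk (fun i => (hc i).lift ((Pr F i).mapCone s)) fun i => (hc i).hom_ext fun j => by
    have h₁ : (hc (i + 1)).lift ((Pr F (i + 1)).mapCone s) ≫ (Pr F (i + 1)).map (c.π.app j) =
      (Pr F (i + 1)).map (s.π.app j) := (hc (i + 1)).fac _ j
    have h₂ : (hc i).lift ((Pr F i).mapCone s) ≫ (Pr F i).map (c.π.app j) =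
      (Pr F i).map (s.π.app j) := (hc i).fac _ j
    refine (Category.assoc _ _ _).trans (Eq.trans ?_ (Category.assoc _ _ _).symm)
    refine (congrArg (_ ≫ ·) (map_comp_prIso (c.π.app j) i).symm).trans ?_
    refine Eq.trans ?_ (congrArg (_ ≫ ·) h₂.symm)
    refine Eq.trans ?_ (map_comp_prIso (s.π.app j) i)
    rw [← h₁]
    exact ((F i).map_comp_assoc _ _ _).symm
  fac s j := by
    ext i
    exact (hc i).fac ((Pr F i).mapCone s) j
  uniq s m hm := by
    ext i
    refine (hc i).uniq ((Pr F i).mapCone s) ((Pr F i).map m) fun j => ?_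
    exact ((Pr F i).map_comp _ _).symm.trans (congrArg _ (hm j))

/-- A cocone in the inverse limit category is colimiting as soon as its components are. -/
def isColimitOfPr [∀ i, PreservesColimitsOfShape J (F i)]
    (c : Cocone K) (hc : ∀ i, IsColimit ((Pr F i).mapCocone c)) : IsColimit c where
  desc s := homMk (fun i => (hc i).desc ((Pr F i).mapCocone s)) fun i =>
    (isColimitOfPreserves (F i) (hc (i + 1))).hom_ext fun j => by
      have h₁ : (Pr F (i + 1)).map (c.ι.app j) ≫ (hc (i + 1)).desc ((Pr F (i + 1)).mapCocone s) =
        (Pr F (i + 1)).map (s.ι.app j) := (hc (i + 1)).fac _ j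
      have h₂ : (Pr F i).map (c.ι.app j) ≫ (hc i).desc ((Pr F i).mapCocone s) =
        (Pr F i).map (s.ι.app j) := (hc i).fac _ j
      refine ((F i).map_comp_assoc _ _ _).symm.trans ?_
      refine (congrArg (fun k => (F i).map k ≫ _) h₁).trans ?_
      refine (map_comp_prIso (s.ι.app j) i).trans ?_
      rw [← h₂]
      exact (map_comp_prIso_assoc (c.ι.app j) i _).symm
  fac s j := by
    ext i
    exact (hc i).fac ((Pr F i).mapCocone s) j
  uniq s m hm := by
    ext i
    refine (hc i).uniq ((Pr F i).mapCocone s) ((Pr F i).map m) fun j => ?_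
    exact ((Pr F i).map_comp _ _).symm.trans (congrArg _ (hm j))

/-- The natural isomorphism comparing the components of a diagram. -/
def diagramIso (i : ℕ) : (K ⋙ Pr F (i + 1)) ⋙ F i ≅ K ⋙ Pr F i :=
  NatIso.ofComponents (fun j => (prIso F i).app (K.obj j)) fun f => map_comp_prIso (K.map f) i

section

variable [∀ i, HasLimitsOfShape J (C i)] [∀ i, PreservesLimitsOfShape J (F i)]

/-- The componentwise limit cone of a diagram in the inverse limit category. -/
noncomputable def limitCone : Cone K where
  pt :=
    { obj i := limit (K ⋙ Pr F i)
      iso i := (isLimitOfPreserves (F i) (limit.isLimit (K ⋙ Pr F (i + 1)))).conePointsIsoOfNatIso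
        (limit.isLimit (K ⋙ Pr F i)) (diagramIso K i) }
  π :=
    { app j := ⟨fun i => limit.π (K ⋙ Pr F i) j, fun i =>
        ((isLimitOfPreserves (F i) (limit.isLimit _)).conePointsIsoOfNatIso_hom_comp
          (limit.isLimit (K ⋙ Pr F i)) (diagramIso K i) j).symm⟩
      naturality j j' f := by
        ext i
        exact (limit.cone (K ⋙ Pr F i)).π.naturality f }

/-- The components of the componentwise limit cone are limiting. -/
noncomputable def isLimitMapConeLimitCone (i : ℕ) : IsLimit ((Pr F i).mapCone (limitCone K)) :=
  (limit.isLimit (K ⋙ Pr F i)).ofIsoLimit (Cone.ext (Iso.refl _) (fun j => by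
    exact (Category.id_comp _).symm))

lemma hasLimitsOfShape : HasLimitsOfShape J (Obj F) where
  has_limit K := ⟨⟨limitCone K, isLimitOfPr K _ (isLimitMapConeLimitCone K)⟩⟩

instance (i : ℕ) : PreservesLimitsOfShape J (Pr F i) where
  preservesLimit {K} := preservesLimit_of_preserves_limit_cone
    (isLimitOfPr K _ (isLimitMapConeLimitCone K)) (isLimitMapConeLimitCone K i)

end

section

variable [∀ i, HasColimitsOfShape J (C i)] [∀ i, PreservesColimitsOfShape J (F i)]

/-- The componentwise colimit cocone of a diagram in the inverse limit category. -/
noncomputable def colimitCocone : Cocone K where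
  pt :=
    { obj i := colimit (K ⋙ Pr F i)
      iso i := (isColimitOfPreserves (F i)
        (colimit.isColimit (K ⋙ Pr F (i + 1)))).coconePointsIsoOfNatIso
        (colimit.isColimit (K ⋙ Pr F i)) (diagramIso K i) }
  ι :=
    { app j := ⟨fun i => colimit.ι (K ⋙ Pr F i) j, fun i =>
        ((isColimitOfPreserves (F i) (colimit.isColimit _)).comp_coconePointsIsoOfNatIso_hom
          (colimit.isColimit (K ⋙ Pr F i)) (diagramIso K i) j)⟩
      naturality j j' f := by
        ext i
        exact (colimit.cocone (K ⋙ Pr F i)).ι.naturality f }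

/-- The components of the componentwise colimit cocone are colimiting. -/
noncomputable def isColimitMapCoconeColimitCocone (i : ℕ) :
    IsColimit ((Pr F i).mapCocone (colimitCocone K)) :=
  (colimit.isColimit (K ⋙ Pr F i)).ofIsoColimit (Cocone.ext (Iso.refl _) (fun j => by
    exact Category.comp_id _))

lemma hasColimitsOfShape : HasColimitsOfShape J (Obj F) where
  has_colimit K := ⟨⟨colimitCocone K, isColimitOfPr K _ (isColimitMapCoconeColimitCocone K)⟩⟩

instance (i : ℕ) : PreservesColimitsOfShape J (Pr F i) where
  preservesColimit {K} := preservesColimit_of_preserves_colimit_cocone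
    (isColimitOfPr K _ (isColimitMapCoconeColimitCocone K)) (isColimitMapCoconeColimitCocone K i)

end

end Limits

section Preadditive

variable [∀ i, Preadditive (C i)] [∀ i, (F i).Additive]

instance (X Y : Obj F) : Zero (X ⟶ Y) := ⟨⟨fun _ => 0, fun i => by simp⟩⟩

instance (X Y : Obj F) : Add (X ⟶ Y) :=
  ⟨fun f g => homMk (fun i => (Pr F i).map f + (Pr F i).map g) fun i => by
    rw [Functor.map_add, Preadditive.add_comp, Preadditive.comp_add, map_comp_prIso,
      map_comp_prIso]⟩

instance (X Y : Obj F) : Neg (X ⟶ Y) :=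
  ⟨fun f => homMk (fun i => -(Pr F i).map f) fun i => by
    rw [Functor.map_neg, Preadditive.neg_comp, Preadditive.comp_neg, map_comp_prIso]⟩

lemma pr_map_zero (X Y : Obj F) (i : ℕ) : (Pr F i).map (0 : X ⟶ Y) = 0 := rfl

lemma pr_map_add {X Y : Obj F} (f g : X ⟶ Y) (i : ℕ) :
    (Pr F i).map (f + g) = (Pr F i).map f + (Pr F i).map g := rfl

lemma pr_map_neg {X Y : Obj F} (f : X ⟶ Y) (i : ℕ) :
    (Pr F i).map (-f) = -(Pr F i).map f := rfl

instance (X Y : Obj F) : AddCommGroup (X ⟶ Y) where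
  add_assoc f g h := by ext i; simp only [pr_map_add, add_assoc]
  zero_add f := by ext i; simp only [pr_map_add, pr_map_zero, zero_add]
  add_zero f := by ext i; simp only [pr_map_add, pr_map_zero, add_zero]
  neg_add_cancel f := by ext i; simp only [pr_map_add, pr_map_neg, pr_map_zero, neg_add_cancel]
  add_comm f g := by ext i; simp only [pr_map_add, add_comm]
  nsmul := nsmulRec
  zsmul := zsmulRec

/-- The componentwise preadditive structure on the inverse limit category. -/
abbrev preadditive : Preadditive (Obj F) where
  add_comp _ _ _ f f' g := by
    ext i; simp only [pr_map_add, Functor.map_comp, Preadditive.add_comp]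
  comp_add _ _ _ f g g' := by
    ext i; simp only [pr_map_add, Functor.map_comp, Preadditive.comp_add]

attribute [local instance] preadditive in
lemma additive_pr (i : ℕ) : (Pr F i).Additive where

end Preadditive

section Abelian

variable [∀ i, Abelian (C i)] [∀ i, PreservesFiniteLimits (F i)]
  [∀ i, PreservesFiniteColimits (F i)]

instance (i : ℕ) : (F i).Additive := (F i).additive_of_preserves_binary_products

attribute [local instance] preadditive additive_pr hasLimitsOfShape hasColimitsOfShape

instance (i : ℕ) : PreservesFiniteColimits (Pr F i) := ⟨fun _ _ _ => inferInstance⟩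

instance (i : ℕ) : PreservesFiniteLimits (Pr F i) := ⟨fun _ _ _ => inferInstance⟩

lemma isIso_coimageImageComparison {X Y : Obj F} (f : X ⟶ Y) :
    IsIso (Abelian.coimageImageComparison f) := by
  have (i : ℕ) : IsIso ((Pr F i).map (Abelian.coimageImageComparison f)) := by
    have h := Abelian.PreservesCoimage.hom_coimageImageComparison (Pr F i) f
    exact IsIso.of_isIso_fac_right h.symm
  exact isIso_of_forall_pr _ this

/-- The inverse limit of abelian categories along exact functors is abelian. -/
noncomputable abbrev abelian : Abelian (Obj F) :=
  have : HasFiniteProducts (Obj F) := ⟨fun _ => inferInstance⟩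
  have : ∀ {X Y : Obj F} (f : X ⟶ Y), IsIso (Abelian.coimageImageComparison f) :=
    isIso_coimageImageComparison
  Abelian.ofCoimageImageComparisonIsIso

end Abelian

end InvLim

open CategoryTheory Limits InvLim in
/-- If the `C_i` are abelian and the `F_{i-1,i}` are exact, then the inverse limit category is
abelian, kernels and cokernels are computed componentwise, and for every morphism `f` the
canonical map `Coim(f) → Im(f)` is an isomorphism. -/
theorem stmt_6 {C : ℕ → Type u} [∀ i, Category.{v} (C i)] [∀ i, Abelian (C i)]
    (F : ∀ i : ℕ, C (i + 1) ⥤ C i)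
    [∀ i, PreservesFiniteLimits (F i)] [∀ i, PreservesFiniteColimits (F i)] :
    ∃ Ab : Abelian (InvLim.Obj F), letI := Ab;
      (∀ (X Y : InvLim.Obj F) (f : X ⟶ Y) (i : ℕ),
        ∃ e : (kernel f).obj i ≅ kernel (InvLim.Hom.hom f i),
          InvLim.Hom.hom (kernel.ι f) i = e.hom ≫ kernel.ι (InvLim.Hom.hom f i)) ∧
      (∀ (X Y : InvLim.Obj F) (f : X ⟶ Y) (i : ℕ),
        ∃ e : (cokernel f).obj i ≅ cokernel (InvLim.Hom.hom f i),
          cokernel.π (InvLim.Hom.hom f i) = InvLim.Hom.hom (cokernel.π f) i ≫ e.hom) ∧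
      (∀ (X Y : InvLim.Obj F) (f : X ⟶ Y),
        IsIso (Abelian.coimageImageComparison f)) := by
  let := abelian (F := F)
  have (i : ℕ) : (Pr F i).Additive := additive_pr i
  refine ⟨abelian, fun X Y f i => ⟨PreservesKernel.iso (Pr F i) f, ?_⟩,
    fun X Y f i => ⟨PreservesCokernel.iso (Pr F i) f, ?_⟩, fun X Y f => inferInstance⟩
  · exact (Iso.inv_comp_eq _).1 (PreservesKernel.iso_inv_ι (Pr F i) f)
  · exact (PreservesCokernel.π_iso_hom (Pr F i) f).symm
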